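/- arXiv:1512.05635 — 2 statements merged into one kernel-verified Lean document; each statement's English description precedes it below -/
import Mathlib

section
/- The map δ ↦ ∫_{M_Δ(δ)} f(x) dH^{d−1}(x) is continuous on 𝒟. In particular (taking f = ρ/‖∇Δ‖), the density map δ ↦ f_{Δ,μ}(δ) is uniformly continuous on 𝒟. -/
open MeasureTheory Set Filter Topology
open scoped NNReal ENNReal

/-- A Lipschitz parametrization expands Hausdorff integrals at most by `K ^ k`. -/
lemma LipschitzOnWith.setLIntegral_hausdorffMeasure_le {X Y : Type*}
    [EMetricSpace X] [MeasurableSpace X] [BorelSpace X]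
    [EMetricSpace Y] [MeasurableSpace Y] [BorelSpace Y]
    {K : ℝ≥0} {q : X → Y} {V : Set X} {S : Set Y} {k : ℝ} (hk : 0 ≤ k)
    (hq : LipschitzOnWith K q V) (hV : MeasurableSet V) (hS : S ⊆ q '' V)
    {G : Y → ℝ≥0∞} (hG : Measurable G) :
    ∫⁻ y in S, G y ∂(Measure.hausdorffMeasure k)
      ≤ (K : ℝ≥0∞) ^ k * ∫⁻ x in V, G (q x) ∂(Measure.hausdorffMeasure k) := by
  have hqm : AEMeasurable q ((Measure.hausdorffMeasure k).restrict V) :=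
    hq.continuousOn.aemeasurable hV
  have hle : (Measure.hausdorffMeasure k).restrict S
      ≤ (K : ℝ≥0∞) ^ k • Measure.map q ((Measure.hausdorffMeasure k).restrict V) := by
    refine Measure.le_iff.2 fun A hA => ?_
    rw [Measure.restrict_apply hA, Measure.smul_apply, Measure.map_apply_of_aemeasurable hqm hA,
      Measure.restrict_apply' hV, smul_eq_mul]
    have hsub : A ∩ S ⊆ q '' (q ⁻¹' A ∩ V) := by
      rintro y ⟨hyA, hyS⟩
      obtain ⟨x, hx, rfl⟩ := hS hyS
      exact ⟨x, ⟨hyA, hx⟩, rfl⟩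
    exact (measure_mono hsub).trans ((hq.mono inter_subset_right).hausdorffMeasure_image_le hk)
  calc ∫⁻ y in S, G y ∂(Measure.hausdorffMeasure k)
      ≤ ∫⁻ y, G y ∂((K : ℝ≥0∞) ^ k • Measure.map q ((Measure.hausdorffMeasure k).restrict V)) :=
        lintegral_mono' hle le_rfl
    _ = _ := by
        rw [lintegral_smul_measure, lintegral_map' hG.aemeasurable hqm, smul_eq_mul]

/-- Near a point where the derivative does not vanish, a strictly differentiable function can be
straightened by a chart which is almost isometric along the level sets. -/
lemma HasStrictFDerivAt.exists_chart_almost_isometric {E : Type*} [NormedAddCommGroup E]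
    [NormedSpace ℝ E] [CompleteSpace E] {Δ : E → ℝ} {φ : E →L[ℝ] ℝ} {a : E}
    (hf : HasStrictFDerivAt Δ φ a) (hφ : φ ≠ 0) {K : ℝ≥0} (hK : 1 < K)
    {B : Set E} (hB : B ∈ 𝓝 a) :
    ∃ e : OpenPartialHomeomorph E (ℝ × φ.ker), a ∈ e.source ∧ e.source ⊆ B ∧
      (∀ x, (e x).1 = Δ x) ∧
      ∀ x ∈ e.source, ∀ y ∈ e.source, Δ x = Δ y →
        ‖x - y‖ ≤ K * ‖(e x).2 - (e y).2‖ ∧ ‖(e x).2 - (e y).2‖ ≤ K * ‖x - y‖ := by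
  have hex : ∃ v, φ v = 1 := by
    obtain ⟨w, hw⟩ : ∃ w, φ w ≠ 0 := by
      by_contra! h
      exact hφ (ContinuousLinearMap.ext h)
    exact ⟨(φ w)⁻¹ • w, by simp [hw]⟩
  obtain ⟨v, hv⟩ := hex
  have hrange : φ.range = ⊤ := by
    rw [LinearMap.range_eq_top]
    intro t
    exact ⟨t • v, by simp [hv]⟩
  have hker : φ.ker.ClosedComplemented := φ.ker_closedComplemented_of_finiteDimensional_range
  set e := hf.implicitToOpenPartialHomeomorphOfComplemented Δ φ hrange hker
  set P := Classical.choose hker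
  have hPspec : ∀ w : φ.ker, P w = w := Classical.choose_spec hker
  have hdecomp : ∀ x : E, x - (P x : E) = φ x • (v - (P v : E)) := by
    intro x
    have hmem : x - φ x • v ∈ φ.ker := by simp [hv]
    have h := congrArg (Subtype.val) (hPspec ⟨_, hmem⟩)
    simp only [map_sub, map_smul, Submodule.coe_sub, Submodule.coe_smul] at h
    rw [smul_sub, ← sub_eq_zero]
    rw [← sub_eq_zero] at h
    rw [← neg_eq_zero, ← h]
    abel
  set C : ℝ := ‖v - (P v : E)‖ + 1 with hC
  have hCpos : 0 < C := by positivity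
  have hK' : (1 : ℝ) < K := by exact_mod_cast hK
  set c : ℝ := 1 - (K : ℝ)⁻¹ with hc
  have hcpos : 0 < c := by
    have := inv_lt_one_of_one_lt₀ hK'
    linarith
  obtain ⟨c', hc'⟩ : ∃ c' : ℝ≥0, (c' : ℝ) = c / C := CanLift.prf (c / C) (by positivity)
  obtain ⟨s, hs, happ⟩ := hf.approximates_deriv_on_nhds (c := c')
    (Or.inr (by rw [← NNReal.coe_pos, hc']; positivity))
  obtain ⟨U, hUsub, hUo, haU⟩ := mem_nhds_iff.1 (inter_mem hs hB)
  have hsrc : (e.restrOpen U hUo).source = e.source ∩ U := e.restrOpen_source U hUo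
  have hval : ∀ x, e.restrOpen U hUo x = (Δ x, P (x - a)) := fun x => rfl
  refine ⟨e.restrOpen U hUo, ?_, ?_, fun x => by rw [hval], ?_⟩
  · rw [hsrc]
    exact ⟨hf.mem_implicitToOpenPartialHomeomorphOfComplemented_source hrange hker, haU⟩
  · rw [hsrc]
    exact fun x hx => (hUsub hx.2).2
  · rw [hsrc]
    intro x hx y hy hxy
    have h1 := happ x (hUsub hx.2).1 y (hUsub hy.2).1
    rw [hxy, sub_self, zero_sub, norm_neg, hc'] at h1
    have h2 : ‖(x - y) - (P (x - y) : E)‖ ≤ c * ‖x - y‖ := by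
      rw [hdecomp, norm_smul]
      calc ‖φ (x - y)‖ * ‖v - (P v : E)‖ ≤ (c / C * ‖x - y‖) * C := by
            gcongr
            simp [hC]
        _ = c * ‖x - y‖ := by field_simp
    have h3 : (e.restrOpen U hUo x).2 - (e.restrOpen U hUo y).2 = P (x - y) := by
      simp [hval, ← map_sub]
    rw [h3]
    have h4 : ‖P (x - y)‖ = ‖(P (x - y) : E)‖ := rfl
    rw [h4]
    have h5 := norm_sub_norm_le (x - y) (P (x - y) : E)
    have h6 := norm_sub_norm_le (P (x - y) : E) (x - y)
    rw [norm_sub_rev (P (x - y) : E) (x - y)] at h6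
    have hKpos : (0 : ℝ) < K := by linarith
    have hKc : (K : ℝ) * (1 - c) = 1 := by rw [hc]; field_simp; ring
    have hKc' : 1 + c ≤ K := by nlinarith
    constructor
    · nlinarith [norm_nonneg (x - y)]
    · nlinarith [norm_nonneg (x - y)]

lemma ContinuousOn.measurableSet_level {X : Type*} [TopologicalSpace X] [MeasurableSpace X]
    [OpensMeasurableSpace X] {Δ : X → ℝ} {U : Set X} (hΔ : ContinuousOn Δ U) (hU : IsOpen U)
    (t : ℝ) : MeasurableSet {x ∈ U | Δ x = t} := by
  have h : {x ∈ U | Δ x = t} = U \ (U ∩ Δ ⁻¹' {t}ᶜ) := by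
    ext x
    simp
  rw [h]
  exact hU.measurableSet.diff
    (hΔ.isOpen_inter_preimage hU isOpen_compl_singleton).measurableSet

/-- Extension by zero of a compactly supported function, transported by a chart. -/
lemma OpenPartialHomeomorph.continuous_indicator_comp_symm {X Y : Type*} [TopologicalSpace X]
    [TopologicalSpace Y] [T2Space Y] (e : OpenPartialHomeomorph X Y) {g : X → ℝ}
    (hg : Continuous g) (hgc : HasCompactSupport g) (hgs : tsupport g ⊆ e.source) :
    Continuous (e.target.indicator (g ∘ e.symm)) ∧
      ∀ p ∉ e '' tsupport g, e.target.indicator (g ∘ e.symm) p = 0 := by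
  have hC : IsCompact (e '' tsupport g) := hgc.image_of_continuousOn (e.continuousOn.mono hgs)
  have hzero : ∀ p ∉ e '' tsupport g, e.target.indicator (g ∘ e.symm) p = 0 := by
    intro p hp
    by_cases hpt : p ∈ e.target
    · rw [indicator_of_mem hpt]
      by_contra hne
      exact hp ⟨e.symm p, subset_tsupport g hne, e.right_inv hpt⟩
    · exact indicator_of_notMem hpt _
  refine ⟨continuous_iff_continuousAt.2 fun p => ?_, hzero⟩
  by_cases hpt : p ∈ e.target
  · have h1 : ContinuousAt (g ∘ e.symm) p := hg.continuousAt.comp (e.continuousAt_symm hpt)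
    refine h1.congr ?_
    filter_upwards [e.open_target.mem_nhds hpt] with z hz
    rw [indicator_of_mem hz]
  · have hp : p ∈ (e '' tsupport g)ᶜ := by
      rintro ⟨x, hx, rfl⟩
      exact hpt (e.map_source (hgs hx))
    have h1 : ContinuousAt (fun _ : Y => (0 : ℝ)) p := continuousAt_const
    refine h1.congr ?_
    filter_upwards [hC.isClosed.isOpen_compl.mem_nhds hp] with z hz
    rw [hzero z hz]

/-- In an almost isometric chart, level set integrals are comparable to a continuous function of
the level. -/
lemma OpenPartialHomeomorph.exists_continuous_comparison {E W : Type*} [NormedAddCommGroup E]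
    [MeasurableSpace E] [BorelSpace E] [NormedAddCommGroup W]
    [MeasurableSpace W] [BorelSpace W] {k : ℝ} (hk : 0 ≤ k)
    [IsFiniteMeasureOnCompacts (Measure.hausdorffMeasure k : Measure W)]
    {Δ : E → ℝ} (e : OpenPartialHomeomorph E (ℝ × W)) (he : ∀ x, (e x).1 = Δ x) {K : ℝ≥0}
    (hlip : ∀ x ∈ e.source, ∀ y ∈ e.source, Δ x = Δ y →
        ‖x - y‖ ≤ K * ‖(e x).2 - (e y).2‖ ∧ ‖(e x).2 - (e y).2‖ ≤ K * ‖x - y‖)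
    {g : E → ℝ} (hg : Continuous g) (hg0 : ∀ x, 0 ≤ g x) (hgc : HasCompactSupport g)
    (hgs : tsupport g ⊆ e.source) :
    ∃ J : ℝ → ℝ, Continuous J ∧ (∀ t, 0 ≤ J t) ∧ ∀ t,
      ENNReal.ofReal (J t) ≤ (K : ℝ≥0∞) ^ k *
        ∫⁻ x in {x ∈ e.source | Δ x = t}, ENNReal.ofReal (g x) ∂(Measure.hausdorffMeasure k) ∧
      ∫⁻ x in {x ∈ e.source | Δ x = t}, ENNReal.ofReal (g x) ∂(Measure.hausdorffMeasure k)
        ≤ (K : ℝ≥0∞) ^ k * ENNReal.ofReal (J t) := by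
  obtain ⟨hhc, hh0⟩ := e.continuous_indicator_comp_symm hg hgc hgs
  set h : ℝ × W → ℝ := e.target.indicator (g ∘ e.symm) with hh
  have hhnn : ∀ p, 0 ≤ h p := fun p => indicator_nonneg (fun _ _ => hg0 _) p
  have hhe : ∀ x ∈ e.source, h (e x) = g x := fun x hx => by
    rw [hh, indicator_of_mem (e.map_source hx), Function.comp_apply, e.left_inv hx]
  have hC : IsCompact (e '' tsupport g) := hgc.image_of_continuousOn (e.continuousOn.mono hgs)
  have hC2 : IsCompact (Prod.snd '' (e '' tsupport g)) := hC.image continuous_snd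
  have hzero : ∀ t : ℝ, ∀ y ∉ Prod.snd '' (e '' tsupport g), h (t, y) = 0 :=
    fun t y hy => hh0 _ fun hmem => hy ⟨_, hmem, rfl⟩
  have hcont : ∀ t : ℝ, Continuous fun y => h (t, y) := fun t => hhc.comp (by fun_prop)
  have hint : ∀ t : ℝ, Integrable (fun y => h (t, y)) (Measure.hausdorffMeasure k) := fun t =>
    (hcont t).integrable_of_hasCompactSupport (HasCompactSupport.intro hC2 (hzero t))
  have hJ : ∀ t : ℝ, ENNReal.ofReal (∫ y, h (t, y) ∂(Measure.hausdorffMeasure k))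
      = ∫⁻ y in {y | (t, y) ∈ e.target}, ENNReal.ofReal (h (t, y))
          ∂(Measure.hausdorffMeasure k) := by
    intro t
    rw [ofReal_integral_eq_lintegral_ofReal (hint t) (Eventually.of_forall fun y => hhnn _),
      setLIntegral_eq_of_support_subset]
    intro y hy
    by_contra hyt
    exact hy (by simp only [hh, indicator_of_notMem (show (t, y) ∉ e.target from hyt),
      ENNReal.ofReal_zero])
  refine ⟨fun t => ∫ y, h (t, y) ∂(Measure.hausdorffMeasure k), ?_,
    fun t => integral_nonneg fun y => hhnn _, fun t => ?_⟩
  · rw [← continuousOn_univ]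
    exact continuousOn_integral_of_compact_support (f := fun t y => h (t, y)) hC2
      hhc.continuousOn fun t y _ hy => hzero t y hy
  have hΔc : ContinuousOn Δ e.source :=
    (continuous_fst.comp_continuousOn e.continuousOn).congr fun x _ => (he x).symm
  have hSm := hΔc.measurableSet_level e.open_source t
  have hVm : MeasurableSet {y : W | (t, y) ∈ e.target} :=
    (e.open_target.preimage (by fun_prop : Continuous fun y : W => (t, y))).measurableSet
  have hpair : ∀ x, Δ x = t → (t, (e x).2) = e x := fun x hx => by rw [← hx, ← he]
  rw [hJ]
  constructor
  · have hp : LipschitzOnWith K (fun x => (e x).2) {x ∈ e.source | Δ x = t} :=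
      LipschitzOnWith.of_dist_le_mul fun x hx y hy => by
        rw [dist_eq_norm, dist_eq_norm]
        exact (hlip x hx.1 y hy.1 (hx.2.trans hy.2.symm)).2
    have hS : {y : W | (t, y) ∈ e.target} ⊆ (fun x => (e x).2) '' {x ∈ e.source | Δ x = t} := by
      intro y hy
      refine ⟨e.symm (t, y), ⟨e.map_target hy, ?_⟩, ?_⟩
      · rw [← he, e.right_inv hy]
      · simp only [e.right_inv hy]
    refine (hp.setLIntegral_hausdorffMeasure_le hk hSm hS
      (G := fun y => ENNReal.ofReal (h (t, y))) (hcont t).measurable.ennreal_ofReal).trans_eq ?_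
    congr 1
    refine setLIntegral_congr_fun hSm fun x hx => ?_
    simp only [hpair x hx.2, hhe x hx.1]
  · have hq : LipschitzOnWith K (fun y => e.symm (t, y)) {y : W | (t, y) ∈ e.target} :=
      LipschitzOnWith.of_dist_le_mul fun y hy z hz => by
        rw [dist_eq_norm, dist_eq_norm]
        have := (hlip _ (e.map_target hy) _ (e.map_target hz)
          (by rw [← he, ← he, e.right_inv hy, e.right_inv hz])).1
        rwa [e.right_inv hy, e.right_inv hz] at this
    have hS : {x ∈ e.source | Δ x = t} ⊆
        (fun y => e.symm (t, y)) '' {y : W | (t, y) ∈ e.target} := by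
      intro x hx
      refine ⟨(e x).2, ?_, ?_⟩
      · simpa only [mem_ofPred_eq, hpair x hx.2] using e.map_source hx.1
      · simp only [hpair x hx.2, e.left_inv hx.1]
    refine (hq.setLIntegral_hausdorffMeasure_le hk hVm hS
      (G := fun x => ENNReal.ofReal (g x)) hg.measurable.ennreal_ofReal).trans_eq ?_
    congr 1
    refine setLIntegral_congr_fun hVm fun y hy => ?_
    simp only [hh, indicator_of_mem (show (t, y) ∈ e.target from hy), Function.comp_apply]

lemma ContinuousOn.measurableSet_level_of_isCompact {X : Type*} [TopologicalSpace X] [T2Space X]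
    [MeasurableSpace X] [OpensMeasurableSpace X] {Δ : X → ℝ} {B C : Set X}
    (hΔ : ContinuousOn Δ B) (hB : IsOpen B) (hC : IsCompact C) (hCB : C ⊆ B) (t : ℝ) :
    MeasurableSet {x ∈ C | Δ x = t} := by
  have h : {x ∈ C | Δ x = t} = C ∩ {x ∈ B | Δ x = t} := by
    ext x
    exact ⟨fun hx => ⟨hx.1, hCB hx.1, hx.2⟩, fun hx => ⟨hx.1, hx.2.2⟩⟩
  rw [h]
  exact hC.measurableSet.inter (hΔ.measurableSet_level hB t)

lemma MeasureTheory.setLIntegral_congr_of_eq_zero {X : Type*} [MeasurableSpace X] {μ : Measure X}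
    {S T : Set X} {F : X → ℝ≥0∞} (hS : MeasurableSet S) (hT : MeasurableSet T)
    (h₁ : ∀ x ∈ S \ T, F x = 0) (h₂ : ∀ x ∈ T \ S, F x = 0) :
    ∫⁻ x in S, F x ∂μ = ∫⁻ x in T, F x ∂μ := by
  rw [← lintegral_indicator hS, ← lintegral_indicator hT]
  refine lintegral_congr fun x => ?_
  by_cases hxS : x ∈ S <;> by_cases hxT : x ∈ T <;> simp_all

/-- Local comparison of level set integrals with continuous functions of the level. -/
lemma exists_nhds_levelIntegral_comparison {E : Type*} [NormedAddCommGroup E] [NormedSpace ℝ E]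
    [FiniteDimensional ℝ E] [MeasurableSpace E] [BorelSpace E] {Δ : E → ℝ} {φ : E →L[ℝ] ℝ} {a : E}
    (hf : HasStrictFDerivAt Δ φ a) (hφ : φ ≠ 0) {B : Set E} (hB : B ∈ 𝓝 a)
    {d : ℕ} (hd : Module.finrank ℝ E = d) {L : ℝ≥0} (hL : 1 < L) :
    ∃ U : Set E, IsOpen U ∧ a ∈ U ∧ U ⊆ B ∧ ∀ g : E → ℝ, Continuous g → (∀ x, 0 ≤ g x) →
      HasCompactSupport g → tsupport g ⊆ U →
      ∃ J : ℝ → ℝ, Continuous J ∧ (∀ t, 0 ≤ J t) ∧ ∀ t,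
        ENNReal.ofReal (J t) ≤ L * ∫⁻ x in {x ∈ U | Δ x = t}, ENNReal.ofReal (g x)
          ∂(Measure.hausdorffMeasure ((d : ℝ) - 1)) ∧
        ∫⁻ x in {x ∈ U | Δ x = t}, ENNReal.ofReal (g x)
          ∂(Measure.hausdorffMeasure ((d : ℝ) - 1)) ≤ L * ENNReal.ofReal (J t) := by
  have : CompleteSpace E := FiniteDimensional.complete ℝ E
  have hfin : Module.finrank ℝ φ.ker + 1 = d := by
    rw [← hd]
    refine Module.Dual.finrank_ker_add_one_of_ne_zero (f := (φ : E →ₗ[ℝ] ℝ)) ?_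
    exact fun h => hφ (ContinuousLinearMap.coe_injective h)
  have hk : (d : ℝ) - 1 = (Module.finrank ℝ φ.ker : ℝ) := by
    rw [← hfin]
    push_cast
    ring
  set k : ℝ := (d : ℝ) - 1 with hkdef
  have hk0 : 0 ≤ k := by rw [hk]; positivity
  have hfinite : IsFiniteMeasureOnCompacts (Measure.hausdorffMeasure k : Measure φ.ker) := by
    rw [hk]
    infer_instance
  set K : ℝ≥0 := L ^ (1 / (k + 1)) with hK
  have hK1 : 1 < K := NNReal.one_lt_rpow hL (by positivity)
  have hKL : (K : ℝ≥0∞) ^ k ≤ L := by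
    rw [← ENNReal.coe_rpow_of_nonneg _ hk0, hK, ← NNReal.rpow_mul]
    norm_cast
    calc L ^ (1 / (k + 1) * k) ≤ L ^ (1 : ℝ) := by
          refine NNReal.rpow_le_rpow_of_exponent_le hL.le ?_
          rw [one_div, inv_mul_le_iff₀ (by positivity)]
          linarith
      _ = L := NNReal.rpow_one L
  obtain ⟨e, hae, heB, he, hlip⟩ := hf.exists_chart_almost_isometric hφ hK1 hB
  refine ⟨e.source, e.open_source, hae, heB, fun g hg hg0 hgc hgs => ?_⟩
  obtain ⟨J, hJc, hJ0, hJ⟩ := e.exists_continuous_comparison hk0 he hlip hg hg0 hgc hgs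
  exact ⟨J, hJc, hJ0, fun t => ⟨(hJ t).1.trans (by gcongr), (hJ t).2.trans (by gcongr)⟩⟩

/-- Comparison of level set integrals of a compactly supported function with continuous functions
of the level, by means of a partition of unity. -/
lemma exists_levelIntegral_comparison {E : Type*} [NormedAddCommGroup E] [NormedSpace ℝ E]
    [FiniteDimensional ℝ E] [MeasurableSpace E] [BorelSpace E] {Δ : E → ℝ} {B C : Set E}
    (hB : IsOpen B) (hC : IsCompact C) (hCB : C ⊆ B) (hΔ : ContDiffOn ℝ 1 Δ B)
    {d : ℕ} (hd : Module.finrank ℝ E = d) {g : E → ℝ} (hg : Continuous g) (hg0 : ∀ x, 0 ≤ g x)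
    (hgC : tsupport g ⊆ C) (hreg : ∀ x ∈ tsupport g, fderiv ℝ Δ x ≠ 0) {L : ℝ≥0} (hL : 1 < L) :
    ∃ J : ℝ → ℝ, Continuous J ∧ (∀ t, 0 ≤ J t) ∧ ∀ t,
      ENNReal.ofReal (J t) ≤ L * ∫⁻ x in {x ∈ C | Δ x = t}, ENNReal.ofReal (g x)
        ∂(Measure.hausdorffMeasure ((d : ℝ) - 1)) ∧
      ∫⁻ x in {x ∈ C | Δ x = t}, ENNReal.ofReal (g x)
        ∂(Measure.hausdorffMeasure ((d : ℝ) - 1)) ≤ L * ENNReal.ofReal (J t) := by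
  have hgc : IsCompact (tsupport g) := hC.of_isClosed_subset (isClosed_tsupport g) hgC
  have hloc : ∀ a ∈ tsupport g, _ := fun a ha =>
    exists_nhds_levelIntegral_comparison
      ((hΔ.contDiffAt (hB.mem_nhds (hCB (hgC ha)))).hasStrictFDerivAt one_ne_zero)
      (hreg a ha) (hB.mem_nhds (hCB (hgC ha))) hd hL
  choose! U hUo haU hUB hU using hloc
  obtain ⟨s, hs, hcov⟩ := hgc.elim_nhds_subcover U fun a ha => (hUo a ha).mem_nhds (haU a ha)
  set σ : Fin s.card → E := fun i => (s.equivFin.symm i : E) with hσ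
  have hσs : ∀ i, σ i ∈ tsupport g := fun i => hs _ (s.equivFin.symm i).2
  obtain ⟨χ, hχs, hχ1, hχ01, -⟩ := exists_continuous_sum_one_of_isOpen_isCompact
    (s := fun i => U (σ i)) (fun i => hUo _ (hσs i)) hgc (by
      refine hcov.trans (iUnion₂_subset fun a ha => ?_)
      refine subset_iUnion_of_subset (s.equivFin ⟨a, ha⟩) ?_
      simp [hσ])
  have hts : ∀ i, tsupport (fun x => χ i x * g x) ⊆ tsupport g := fun i =>
    tsupport_mul_subset_right
  have hJ := fun i => hU (σ i) (hσs i) (fun x => χ i x * g x) (by fun_prop)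
    (fun x => mul_nonneg (hχ01 i x).1 (hg0 x))
    (hgc.of_isClosed_subset (isClosed_tsupport _) (hts i))
    (tsupport_mul_subset_left.trans (hχs i))
  choose J hJc hJ0 hJ using hJ
  have hset : ∀ i t, ∫⁻ x in {x ∈ U (σ i) | Δ x = t}, ENNReal.ofReal (χ i x * g x)
        ∂(Measure.hausdorffMeasure ((d : ℝ) - 1)) =
      ∫⁻ x in {x ∈ C | Δ x = t}, ENNReal.ofReal (χ i x * g x)
        ∂(Measure.hausdorffMeasure ((d : ℝ) - 1)) := by
    intro i t
    refine setLIntegral_congr_of_eq_zero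
      (((hΔ.continuousOn.mono (hUB _ (hσs i))).measurableSet_level (hUo _ (hσs i))) t)
      (hΔ.continuousOn.measurableSet_level_of_isCompact hB hC hCB t) ?_ ?_
    · rintro x ⟨hx, hxC⟩
      have hxg : x ∉ tsupport g := fun h => hxC ⟨hgC h, hx.2⟩
      rw [image_eq_zero_of_notMem_tsupport hxg, mul_zero, ENNReal.ofReal_zero]
    · rintro x ⟨hx, hxU⟩
      have hxχ : x ∉ tsupport (χ i) := fun h => hxU ⟨hχs i h, hx.2⟩
      rw [image_eq_zero_of_notMem_tsupport hxχ, zero_mul, ENNReal.ofReal_zero]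
  have hsum : ∀ t, ∫⁻ x in {x ∈ C | Δ x = t}, ENNReal.ofReal (g x)
        ∂(Measure.hausdorffMeasure ((d : ℝ) - 1)) =
      ∑ i, ∫⁻ x in {x ∈ C | Δ x = t}, ENNReal.ofReal (χ i x * g x)
        ∂(Measure.hausdorffMeasure ((d : ℝ) - 1)) := by
    intro t
    rw [← lintegral_finsetSum _ fun i _ => by fun_prop]
    refine lintegral_congr fun x => ?_
    rw [← ENNReal.ofReal_sum_of_nonneg fun i _ => mul_nonneg (hχ01 i x).1 (hg0 x),
      ← Finset.sum_mul]
    by_cases hx : x ∈ tsupport g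
    · have := hχ1 hx
      rw [Finset.sum_apply, Pi.one_apply] at this
      rw [this, one_mul]
    · rw [image_eq_zero_of_notMem_tsupport hx, mul_zero]
  refine ⟨fun t => ∑ i, J i t, by fun_prop, fun t => Finset.sum_nonneg fun i _ => hJ0 i t,
    fun t => ?_⟩
  rw [hsum, ENNReal.ofReal_sum_of_nonneg fun i _ => hJ0 i t, Finset.mul_sum, Finset.mul_sum]
  simp only [← hset]
  exact ⟨Finset.sum_le_sum fun i _ => (hJ i t).1, Finset.sum_le_sum fun i _ => (hJ i t).2⟩

/-- Level set integrals of a compactly supported function depend continuously on the level. -/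
lemma continuous_levelIntegral {E : Type*} [NormedAddCommGroup E] [NormedSpace ℝ E]
    [FiniteDimensional ℝ E] [MeasurableSpace E] [BorelSpace E] {Δ : E → ℝ} {B C : Set E}
    (hB : IsOpen B) (hC : IsCompact C) (hCB : C ⊆ B) (hΔ : ContDiffOn ℝ 1 Δ B)
    {d : ℕ} (hd : Module.finrank ℝ E = d) {g : E → ℝ} (hg : Continuous g) (hg0 : ∀ x, 0 ≤ g x)
    (hgC : tsupport g ⊆ C) (hreg : ∀ x ∈ tsupport g, fderiv ℝ Δ x ≠ 0) :
    (∀ t, IntegrableOn g {x ∈ C | Δ x = t} (Measure.hausdorffMeasure ((d : ℝ) - 1))) ∧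
    Continuous fun t => ∫ x in {x ∈ C | Δ x = t}, g x
        ∂(Measure.hausdorffMeasure ((d : ℝ) - 1)) := by
  have hcomp := fun (L : ℝ≥0) (hL : 1 < L) =>
    exists_levelIntegral_comparison hB hC hCB hΔ hd hg hg0 hgC hreg hL
  have hlt : ∀ t, ∫⁻ x in {x ∈ C | Δ x = t}, ENNReal.ofReal (g x)
      ∂(Measure.hausdorffMeasure ((d : ℝ) - 1)) < ∞ := by
    intro t
    obtain ⟨J, -, -, hJ⟩ := hcomp 2 one_lt_two
    exact (hJ t).2.trans_lt (by finiteness)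
  have hint : ∀ t, IntegrableOn g {x ∈ C | Δ x = t}
      (Measure.hausdorffMeasure ((d : ℝ) - 1)) := fun t =>
    ⟨hg.aestronglyMeasurable, by
      rw [hasFiniteIntegral_iff_ofReal (Eventually.of_forall hg0)]
      exact hlt t⟩
  refine ⟨hint, ?_⟩
  set I : ℝ → ℝ := fun t => ∫ x in {x ∈ C | Δ x = t}, g x
        ∂(Measure.hausdorffMeasure ((d : ℝ) - 1)) with hI
  have hI0 : ∀ t, 0 ≤ I t := fun t => integral_nonneg fun x => hg0 x
  have hIe : ∀ t, ∫⁻ x in {x ∈ C | Δ x = t}, ENNReal.ofReal (g x)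
      ∂(Measure.hausdorffMeasure ((d : ℝ) - 1)) = ENNReal.ofReal (I t) := fun t =>
    (ofReal_integral_eq_lintegral_ofReal (hint t) (Eventually.of_forall hg0)).symm
  have hreal : ∀ L : ℝ, 1 < L → ∃ J : ℝ → ℝ, Continuous J ∧
      ∀ t, J t ≤ L * I t ∧ I t ≤ L * J t := by
    intro L hL
    have hL0 : 0 ≤ L := by linarith
    lift L to ℝ≥0 using hL0
    obtain ⟨J, hJc, hJ0, hJ⟩ := hcomp L (by exact_mod_cast hL)
    refine ⟨J, hJc, fun t => ?_⟩
    have h := hJ t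
    rw [hIe, ← ENNReal.ofReal_coe_nnreal, ← ENNReal.ofReal_mul L.coe_nonneg,
      ← ENNReal.ofReal_mul L.coe_nonneg] at h
    exact ⟨(ENNReal.ofReal_le_ofReal_iff (mul_nonneg L.coe_nonneg (hI0 t))).1 h.1,
      (ENNReal.ofReal_le_ofReal_iff (mul_nonneg L.coe_nonneg (hJ0 t))).1 h.2⟩
  refine continuous_iff_continuousAt.2 fun t₀ => tendsto_order.2 ⟨fun a ha => ?_, fun b hb => ?_⟩
  · obtain ⟨L, hLa, hL⟩ : ∃ L : ℝ, L ^ 2 * a < I t₀ ∧ 1 < L := by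
      have hc : ContinuousAt (fun L : ℝ => L ^ 2 * a) 1 := by fun_prop
      have hev : ∀ᶠ L in 𝓝 (1 : ℝ), L ^ 2 * a < I t₀ := hc.eventually_lt_const (by simpa using ha)
      exact ((hev.filter_mono nhdsWithin_le_nhds).and (self_mem_nhdsWithin (s := Ioi 1))).exists
    obtain ⟨J, hJc, hJ⟩ := hreal L hL
    have h0 : L * a < J t₀ := by nlinarith [(hJ t₀).2]
    filter_upwards [hJc.continuousAt.eventually_const_lt h0] with t ht
    nlinarith [(hJ t).1]
  · obtain ⟨L, hLb, hL⟩ : ∃ L : ℝ, L ^ 2 * I t₀ < b ∧ 1 < L := by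
      have hc : ContinuousAt (fun L : ℝ => L ^ 2 * I t₀) 1 := by fun_prop
      have hev : ∀ᶠ L in 𝓝 (1 : ℝ), L ^ 2 * I t₀ < b := hc.eventually_lt_const (by simpa using hb)
      exact ((hev.filter_mono nhdsWithin_le_nhds).and (self_mem_nhdsWithin (s := Ioi 1))).exists
    obtain ⟨J, hJc, hJ⟩ := hreal L hL
    have h0 : L * J t₀ < b := by nlinarith [(hJ t₀).1]
    filter_upwards [(hJc.const_mul L).continuousAt.eventually_lt_const h0] with t ht
    exact (hJ t).2.trans_lt ht

/-- Cutting off along the levels: level set integrals of a nonnegative function vanishing outside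
a compact set and continuous near one regular level set are continuous at that level. -/
lemma continuousAt_levelIntegral_of_nonneg {E : Type*} [NormedAddCommGroup E] [NormedSpace ℝ E]
    [FiniteDimensional ℝ E] [MeasurableSpace E] [BorelSpace E] {Δ : E → ℝ} {B C O : Set E}
    (hB : IsOpen B) (hC : IsCompact C) (hCB : C ⊆ B) (hΔ : ContDiffOn ℝ 1 Δ B)
    {d : ℕ} (hd : Module.finrank ℝ E = d) {t₀ : ℝ} (hO : IsOpen O)
    (hCO : {x ∈ C | Δ x = t₀} ⊆ O) (hreg : ∀ x ∈ C, Δ x = t₀ → fderiv ℝ Δ x ≠ 0)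
    {f : E → ℝ} (hf : ContinuousOn f O) (hf0 : ∀ x, 0 ≤ f x) (hfC : ∀ x ∉ C, f x = 0) :
    (∀ᶠ t in 𝓝 t₀,
      IntegrableOn f {x ∈ C | Δ x = t} (Measure.hausdorffMeasure ((d : ℝ) - 1))) ∧
    ContinuousAt (fun t => ∫ x in {x ∈ C | Δ x = t}, f x
        ∂(Measure.hausdorffMeasure ((d : ℝ) - 1))) t₀ := by
  have hΔc : ∀ x ∈ C, ContinuousAt Δ x := fun x hx =>
    hΔ.continuousOn.continuousAt (hB.mem_nhds (hCB hx))
  set R : Set E := B ∩ fderiv ℝ Δ ⁻¹' {0}ᶜ with hR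
  have hRo : IsOpen R := (hΔ.continuousOn_fderiv_of_isOpen hB le_rfl).isOpen_inter_preimage hB
    isOpen_compl_singleton
  have hbad : IsCompact (Δ '' (C \ (O ∩ R))) :=
    (hC.diff (hO.inter hRo)).image_of_continuousOn
      fun x hx => (hΔc x hx.1).continuousWithinAt
  have ht₀ : t₀ ∈ (Δ '' (C \ (O ∩ R)))ᶜ := by
    rintro ⟨x, ⟨hxC, hxO⟩, hxt⟩
    exact hxO ⟨hCO ⟨hxC, hxt⟩, hCB hxC, hreg x hxC hxt⟩
  obtain ⟨r, hr, hrV⟩ := Metric.nhds_basis_closedBall.mem_iff.1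
    (hbad.isClosed.isOpen_compl.mem_nhds ht₀)
  let χ : ContDiffBump t₀ := ⟨r / 2, r, by positivity, by linarith⟩
  have hχ1 : ∀ t ∈ Metric.closedBall t₀ (r / 2), χ t = 1 := fun t ht =>
    χ.one_of_mem_closedBall ht
  have hχ0 : ∀ x ∈ C \ (O ∩ R), (fun y => χ (Δ y) * f y) =ᶠ[𝓝 x] 0 := by
    intro x hx
    have hxs : Δ x ∉ tsupport χ := by
      rw [χ.tsupport_eq]
      exact fun h => hrV h ⟨x, hx, rfl⟩
    filter_upwards [(hΔc x hx.1).eventually (notMem_tsupport_iff_eventuallyEq.1 hxs)] with y hy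
    simp [hy]
  set g : E → ℝ := fun y => χ (Δ y) * f y with hg
  have hgc : Continuous g := by
    refine continuous_iff_continuousAt.2 fun x => ?_
    by_cases hxC : x ∈ C
    · by_cases hx : x ∈ O ∩ R
      · exact (χ.continuous.continuousAt.comp (hΔc x hxC)).mul
          (hf.continuousAt (hO.mem_nhds hx.1))
      · exact (continuousAt_const (y := (0 : ℝ))).congr (hχ0 x ⟨hxC, hx⟩).symm
    · refine (continuousAt_const (y := (0 : ℝ))).congr ?_
      filter_upwards [hC.isClosed.isOpen_compl.mem_nhds hxC] with y hy
      simp [hg, hfC y hy]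
  have hgC : tsupport g ⊆ C := closure_minimal
    (fun x hx => by
      by_contra hxC
      exact hx (by simp [hg, hfC x hxC])) hC.isClosed
  have hgreg : ∀ x ∈ tsupport g, fderiv ℝ Δ x ≠ 0 := by
    intro x hx
    by_contra h
    have hxR : x ∈ C \ (O ∩ R) := ⟨hgC hx, fun hxR => hxR.2.2 h⟩
    exact notMem_tsupport_iff_eventuallyEq.2 (hχ0 x hxR) hx
  obtain ⟨hgint, hgcont⟩ := continuous_levelIntegral hB hC hCB hΔ hd hgc
    (fun x => mul_nonneg χ.nonneg (hf0 x)) hgC hgreg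
  have hEq : ∀ᶠ t in 𝓝 t₀, EqOn g f {x ∈ C | Δ x = t} := by
    filter_upwards [Metric.closedBall_mem_nhds t₀ (half_pos hr)] with t ht x hx
    simp only [hg]
    rw [hx.2, hχ1 t ht, one_mul]
  have hm := hΔ.continuousOn.measurableSet_level_of_isCompact hB hC hCB
  refine ⟨hEq.mono fun t ht => (hgint t).congr_fun ht (hm t), hgcont.continuousAt.congr ?_⟩
  exact hEq.mono fun t ht => setIntegral_congr_fun (hm t) ht

/-- Level set integrals of a function vanishing outside a compact set and continuous near one
regular level set are continuous at that level. -/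
lemma continuousAt_levelIntegral {E : Type*} [NormedAddCommGroup E] [NormedSpace ℝ E]
    [FiniteDimensional ℝ E] [MeasurableSpace E] [BorelSpace E] {Δ : E → ℝ} {B C O : Set E}
    (hB : IsOpen B) (hC : IsCompact C) (hCB : C ⊆ B) (hΔ : ContDiffOn ℝ 1 Δ B)
    {d : ℕ} (hd : Module.finrank ℝ E = d) {t₀ : ℝ} (hO : IsOpen O)
    (hCO : {x ∈ C | Δ x = t₀} ⊆ O) (hreg : ∀ x ∈ C, Δ x = t₀ → fderiv ℝ Δ x ≠ 0)
    {f : E → ℝ} (hf : ContinuousOn f O) (hfC : ∀ x ∉ C, f x = 0) :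
    ContinuousAt (fun t => ∫ x in {x ∈ C | Δ x = t}, f x
        ∂(Measure.hausdorffMeasure ((d : ℝ) - 1))) t₀ := by
  obtain ⟨hpi, hpc⟩ := continuousAt_levelIntegral_of_nonneg hB hC hCB hΔ hd hO hCO hreg
    (f := fun x => max (f x) 0) (hf.sup continuousOn_const) (fun x => le_max_right _ _)
    (fun x hx => by simp [hfC x hx])
  obtain ⟨hni, hnc⟩ := continuousAt_levelIntegral_of_nonneg hB hC hCB hΔ hd hO hCO hreg
    (f := fun x => max (-f x) 0) (hf.neg.sup continuousOn_const) (fun x => le_max_right _ _)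
    (fun x hx => by simp [hfC x hx])
  refine (hpc.sub hnc).congr ?_
  filter_upwards [hpi, hni] with t hp hn
  rw [Pi.sub_apply, ← integral_sub hp hn]
  refine integral_congr_ae (Eventually.of_forall fun x => ?_)
  exact max_zero_sub_eq_self (f x)

/-- Under S.1 and S.2, for `𝒟` a compact set of regular values, the map
`δ ↦ ∫_{M_Δ(δ)} f dH^{d-1}` is continuous on `𝒟`, and in particular the density
`δ ↦ f_{Δ,μ}(δ) = ∫_{M_Δ(δ)} ρ/‖∇Δ‖ dH^{d-1}` is uniformly continuous on `𝒟`. -/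
theorem stmt_1
    (d : ℕ) (hd : 1 ≤ d)
    (𝒳 B : Set (EuclideanSpace ℝ (Fin d)))
    (h𝒳open : IsOpen 𝒳) (h𝒳cpt : IsCompact (closure 𝒳))
    (hBopen : IsOpen B) (h𝒳B : closure 𝒳 ⊆ B)
    (Δ ρ : EuclideanSpace ℝ (Fin d) → ℝ)
    (hΔ : ContDiffOn ℝ 1 Δ B)
    (hρ0 : ∀ x, 0 ≤ ρ x) (hρc : ContinuousOn ρ B)
    (hρvanish : ∀ x ∈ B \ 𝒳, ρ x = 0)
    (μ : Measure (EuclideanSpace ℝ (Fin d)))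
    (hμ : μ = volume.withDensity fun x => ENNReal.ofReal (ρ x))
    (hprob : IsProbabilityMeasure μ)
    (hS2 : ∀ δ' : ℝ, (∀ x ∈ closure 𝒳, Δ x = δ' → gradient Δ x ≠ 0) →
      Finite (ConnectedComponents ↥{x ∈ closure 𝒳 | Δ x = δ'}))
    (𝒟 : Set ℝ) (h𝒟cpt : IsCompact 𝒟)
    (h𝒟reg : ∀ δ ∈ 𝒟, ∀ x ∈ closure 𝒳, Δ x = δ → gradient Δ x ≠ 0)
    (η : ℝ) (hη : 0 < η)
    (hthick : Metric.thickening η (closure 𝒳) ⊆ B)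
    (f : EuclideanSpace ℝ (Fin d) → ℝ)
    (hfmeas : Measurable ((Metric.thickening η (closure 𝒳)).restrict f))
    (hfvanish : ∀ x ∉ 𝒳, f x = 0)
    (hfcont : ∀ δ ∈ 𝒟, ∃ η₁ ∈ Set.Ioo 0 η,
      ContinuousOn f {x ∈ Metric.thickening η₁ (closure 𝒳) | |Δ x - δ| < η₁}) :
    ContinuousOn (fun δ => ∫ x in {x ∈ closure 𝒳 | Δ x = δ}, f x
        ∂(Measure.hausdorffMeasure ((d : ℝ) - 1))) 𝒟 ∧
    UniformContinuousOn (fun δ => ∫ x in {x ∈ closure 𝒳 | Δ x = δ},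
        ρ x / ‖gradient Δ x‖ ∂(Measure.hausdorffMeasure ((d : ℝ) - 1))) 𝒟 := by
  have hgrad : ∀ x, gradient Δ x ≠ 0 → fderiv ℝ Δ x ≠ 0 := fun x hx h => hx (by simp [gradient, h])
  have hfin : Module.finrank ℝ (EuclideanSpace ℝ (Fin d)) = d := by simp
  constructor
  · intro δ hδ
    obtain ⟨η₁, ⟨hη₁, hη₁η⟩, hcont⟩ := hfcont δ hδ
    have hsub : Metric.thickening η₁ (closure 𝒳) ⊆ B :=
      (Metric.thickening_mono hη₁η.le _).trans hthick
    have hO : IsOpen {x ∈ Metric.thickening η₁ (closure 𝒳) | |Δ x - δ| < η₁} :=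
      ((hΔ.continuousOn.mono hsub).sub continuousOn_const).abs.isOpen_inter_preimage
        Metric.isOpen_thickening isOpen_Iio
    refine (continuousAt_levelIntegral hBopen h𝒳cpt h𝒳B hΔ hfin hO ?_
      (fun x hx hxδ => hgrad x (h𝒟reg δ hδ x hx hxδ)) hcont
      (fun x hx => hfvanish x fun h => hx (subset_closure h))).continuousWithinAt
    rintro x ⟨hx, hxδ⟩
    exact ⟨Metric.self_subset_thickening hη₁ _ hx, by simpa [hxδ] using hη₁⟩
  · refine h𝒟cpt.uniformContinuousOn_of_continuous fun δ hδ => ?_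
    have hfd : ContinuousOn (gradient Δ) B :=
      (LinearIsometryEquiv.continuous _).comp_continuousOn
        (hΔ.continuousOn_fderiv_of_isOpen hBopen le_rfl)
    have hind : ∀ x ∈ B, (closure 𝒳).indicator (fun x => ρ x / ‖gradient Δ x‖) x
        = ρ x / ‖gradient Δ x‖ := by
      intro x hx
      by_cases h : x ∈ closure 𝒳
      · exact indicator_of_mem h _
      · rw [indicator_of_notMem h, hρvanish x ⟨hx, fun h' => h (subset_closure h')⟩, zero_div]
    have hO : IsOpen (B ∩ gradient Δ ⁻¹' {0}ᶜ) :=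
      hfd.isOpen_inter_preimage hBopen isOpen_compl_singleton
    have hcont : ContinuousOn ((closure 𝒳).indicator fun x => ρ x / ‖gradient Δ x‖)
        (B ∩ gradient Δ ⁻¹' {0}ᶜ) :=
      ((hρc.mono inter_subset_left).div (hfd.mono inter_subset_left).norm
        fun x hx => norm_ne_zero_iff.2 hx.2).congr fun x hx => hind x hx.1
    have hmain := continuousAt_levelIntegral hBopen h𝒳cpt h𝒳B hΔ hfin hO
      (fun x hx => ⟨h𝒳B hx.1, h𝒟reg δ hδ x hx.1 hx.2⟩)
      (fun x hx hxδ => hgrad x (h𝒟reg δ hδ x hx hxδ)) hcont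
      (fun x hx => indicator_of_notMem hx _)
    refine (hmain.congr (Eventually.of_forall fun t => ?_)).continuousWithinAt
    exact setIntegral_congr_fun
      (hΔ.continuousOn.measurableSet_level_of_isCompact hBopen h𝒳cpt h𝒳B t)
      fun x hx => hind x (h𝒳B hx.1)
end

section
/- For every Δ̃ ∈ 𝔉 and every δ ∈ 𝒱 there exist indices i ∈ {1,…,r} and j ∈ {1,…,q} such that, pointwise in x ∈ ℝ^d, 1{Δ_j(x) + ζ ≤ a_i} ≤ 1{Δ̃(x) ≤ δ} ≤ 1{Δ_j(x) − ζ ≤ b_i}, and the bracket has L²(μ)-size at most √(3K₁ζ): ∫ (1{Δ_j(x) − ζ ≤ b_i} − 1{Δ_j(x) + ζ ≤ a_i})² dμ(x) ≤ 3K₁ζ. Consequently the class 𝒢 = {1{Δ̃ ≤ δ} : Δ̃ ∈ 𝔉, δ ∈ 𝒱} is covered by at most r·q brackets of L²(μ)-size √(3K₁ζ). -/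
open MeasureTheory Set Filter Topology

/-- If a measurable `g` has a density bound on both sides of `a`, then the bracket
`[1{g + ζ ≤ a}, 1{g - ζ ≤ b}]` has squared `L²(μ)`-size at most `3 K ζ`. -/
theorem integral_sq_indicator_bracket_le {α : Type*} [MeasurableSpace α]
    {μ : Measure α} [IsFiniteMeasure μ] {g : α → ℝ} (hg : Measurable g) {K η₀ ζ a b : ℝ}
    (hK : 0 ≤ K) (hζ : 0 < ζ) (hζη : 2 * ζ ≤ η₀) (hab : a ≤ b) (hba : b - a < ζ)
    (hdens : ∀ η ∈ Set.Ioc (0 : ℝ) η₀,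
      (μ {x | a < g x ∧ g x ≤ a + η}).toReal ≤ K * η ∧
      (μ {x | a - η < g x ∧ g x ≤ a}).toReal ≤ K * η) :
    ∫ x, (Set.indicator {x | g x - ζ ≤ b} (fun _ => (1 : ℝ)) x
        - Set.indicator {x | g x + ζ ≤ a} (fun _ => (1 : ℝ)) x) ^ 2 ∂μ ≤ 3 * K * ζ := by
  have hsq : ∀ x, (Set.indicator {x | g x - ζ ≤ b} (fun _ => (1 : ℝ)) x
      - Set.indicator {x | g x + ζ ≤ a} (fun _ => (1 : ℝ)) x) ^ 2
      = Set.indicator (g ⁻¹' Set.Ioc (a - ζ) (b + ζ)) 1 x := by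
    classical
    intro x
    simp only [Set.indicator_apply, Set.mem_ofPred_eq, Set.mem_preimage, Set.mem_Ioc, Pi.one_apply]
    split_ifs <;> grind
  simp_rw [hsq]
  rw [integral_indicator_one (hg measurableSet_Ioc)]
  have hunion : g ⁻¹' Set.Ioc (a - ζ) (b + ζ) ⊆
      {x | a < g x ∧ g x ≤ a + (b + ζ - a)} ∪ {x | a - ζ < g x ∧ g x ≤ a} := by
    rintro x ⟨h₁, h₂⟩
    rcases le_or_gt (g x) a with h | h
    · exact Or.inr ⟨h₁, h⟩
    · exact Or.inl ⟨h, by linarith⟩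
  have hright := (hdens (b + ζ - a) ⟨by linarith, by linarith⟩).1
  have hleft := (hdens ζ ⟨hζ, by linarith⟩).2
  have hle := (measureReal_mono (μ := μ) hunion).trans (measureReal_union_le _ _)
  have hmul : K * (b + ζ - a) ≤ K * (2 * ζ) := mul_le_mul_of_nonneg_left (by linarith) hK
  simp only [Measure.real] at hle ⊢
  linarith

/-- Bracketing. Under the uniform density bound, the interval cover of `𝒱`
and the sup-norm net of `𝔉`, every indicator `1{Δ̃ ≤ δ}` with `Δ̃ ∈ 𝔉`, `δ ∈ 𝒱` is
contained in a bracket `[1{Δ_j + ζ ≤ a_i}, 1{Δ_j - ζ ≤ b_i}]` of L²(μ)-size at most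
`√(3K₁ζ)`; consequently `𝒢` is covered by at most `r·q` such brackets. -/
theorem stmt_13
    (d : ℕ) (hd : 1 ≤ d)
    (μ : Measure (EuclideanSpace ℝ (Fin d))) (hprob : IsProbabilityMeasure μ)
    (𝒱 : Set ℝ)
    (𝔉 : Set (EuclideanSpace ℝ (Fin d) → ℝ))
    (h𝔉meas : ∀ f ∈ 𝔉, Measurable f)
    (K₁ η₀ ζ : ℝ) (hK₁ : 0 < K₁) (hη₀ : 0 < η₀) (hζ : ζ ∈ Set.Ioc 0 (η₀ / 2))
    (hdens : ∀ f ∈ 𝔉, ∀ δ ∈ 𝒱, ∀ η ∈ Set.Ioc (0:ℝ) η₀,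
      (μ {x | δ < f x ∧ f x ≤ δ + η}).toReal ≤ K₁ * η ∧
      (μ {x | δ - η < f x ∧ f x ≤ δ}).toReal ≤ K₁ * η)
    (r q : ℕ)
    (a b : Fin r → ℝ)
    (hab : ∀ i, b i - a i < ζ)
    (hsub : ∀ i, Set.Icc (a i) (b i) ⊆ 𝒱)
    (hcover : 𝒱 ⊆ ⋃ i, Set.Icc (a i) (b i))
    (Δs : Fin q → EuclideanSpace ℝ (Fin d) → ℝ)
    (hΔs𝔉 : ∀ j, Δs j ∈ 𝔉)
    (hnet : ∀ f ∈ 𝔉, ∃ j : Fin q, ∀ x, |f x - Δs j x| < ζ) :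
    (∀ f ∈ 𝔉, ∀ δ ∈ 𝒱, ∃ i : Fin r, ∃ j : Fin q,
      (∀ x, Set.indicator {x | Δs j x + ζ ≤ a i} (fun _ => (1:ℝ)) x
              ≤ Set.indicator {x | f x ≤ δ} (fun _ => (1:ℝ)) x ∧
            Set.indicator {x | f x ≤ δ} (fun _ => (1:ℝ)) x
              ≤ Set.indicator {x | Δs j x - ζ ≤ b i} (fun _ => (1:ℝ)) x) ∧
      (∫ x, (Set.indicator {x | Δs j x - ζ ≤ b i} (fun _ => (1:ℝ)) x
              - Set.indicator {x | Δs j x + ζ ≤ a i} (fun _ => (1:ℝ)) x) ^ 2 ∂μ)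
        ≤ 3 * K₁ * ζ) ∧
    (∃ br : Finset ((EuclideanSpace ℝ (Fin d) → ℝ) × (EuclideanSpace ℝ (Fin d) → ℝ)),
      br.card ≤ r * q ∧
      ∀ f ∈ 𝔉, ∀ δ ∈ 𝒱, ∃ p ∈ br,
        (∀ x, p.1 x ≤ Set.indicator {x | f x ≤ δ} (fun _ => (1:ℝ)) x ∧
              Set.indicator {x | f x ≤ δ} (fun _ => (1:ℝ)) x ≤ p.2 x) ∧
        (∫ x, (p.2 x - p.1 x) ^ 2 ∂μ) ≤ 3 * K₁ * ζ) := by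
  have hbracket : ∀ f ∈ 𝔉, ∀ δ ∈ 𝒱, ∃ i : Fin r, ∃ j : Fin q,
      (∀ x, Set.indicator {x | Δs j x + ζ ≤ a i} (fun _ => (1:ℝ)) x
              ≤ Set.indicator {x | f x ≤ δ} (fun _ => (1:ℝ)) x ∧
            Set.indicator {x | f x ≤ δ} (fun _ => (1:ℝ)) x
              ≤ Set.indicator {x | Δs j x - ζ ≤ b i} (fun _ => (1:ℝ)) x) ∧
      (∫ x, (Set.indicator {x | Δs j x - ζ ≤ b i} (fun _ => (1:ℝ)) x
              - Set.indicator {x | Δs j x + ζ ≤ a i} (fun _ => (1:ℝ)) x) ^ 2 ∂μ)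
        ≤ 3 * K₁ * ζ := by
    intro f hf δ hδ
    obtain ⟨i, haδ, hδb⟩ := Set.mem_iUnion.1 (hcover hδ)
    obtain ⟨j, hj⟩ := hnet f hf
    have hle : a i ≤ b i := haδ.trans hδb
    refine ⟨i, j, fun x => ⟨?_, ?_⟩, ?_⟩
    · refine Set.indicator_le_indicator_of_subset (fun y hy => ?_) (fun _ => zero_le_one) x
      have := abs_lt.1 (hj y)
      simp only [Set.mem_ofPred_eq] at hy ⊢
      linarith
    · refine Set.indicator_le_indicator_of_subset (fun y hy => ?_) (fun _ => zero_le_one) x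
      have := abs_lt.1 (hj y)
      simp only [Set.mem_ofPred_eq] at hy ⊢
      linarith
    · exact integral_sq_indicator_bracket_le (h𝔉meas _ (hΔs𝔉 j)) hK₁.le hζ.1
        (by linarith [hζ.2]) hle (hab i)
        (hdens _ (hΔs𝔉 j) _ (hsub i (Set.left_mem_Icc.2 hle)))
  refine ⟨hbracket, ?_⟩
  classical
  let bracket : Fin r × Fin q →
      (EuclideanSpace ℝ (Fin d) → ℝ) × (EuclideanSpace ℝ (Fin d) → ℝ) := fun ij =>
    (Set.indicator {x | Δs ij.2 x + ζ ≤ a ij.1} (fun _ => (1:ℝ)),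
      Set.indicator {x | Δs ij.2 x - ζ ≤ b ij.1} (fun _ => (1:ℝ)))
  refine ⟨Finset.univ.image bracket, ?_, fun f hf δ hδ => ?_⟩
  · simpa using Finset.card_image_le (s := Finset.univ) (f := bracket)
  · obtain ⟨i, j, h⟩ := hbracket f hf δ hδ
    exact ⟨bracket (i, j), Finset.mem_image_of_mem _ (Finset.mem_univ _), h⟩
end
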